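/- Let f : ℝ → ℝ be a continuous piecewise linear function with p pieces. If f is represented by a ReLU DNN with k ≥ 1 hidden layers (depth k+1), then the size of that DNN is at least (1/2)·k·p^{1/k} − 1. Conversely, any continuous piecewise linear function f : ℝ → ℝ represented by a ReLU DNN of depth k+1 and size at most s has at most (2s/k)^k pieces. -/

import Mathlib

open scoped BigOperators

noncomputable section

/-- Coordinatewise ReLU activation. -/
def reluVec {n : ℕ} (x : Fin n → ℝ) : Fin n → ℝ := fun i => max (x i) 0

/-- `T` is an affine transformation. -/
def IsAffineT {n m : ℕ} (T : (Fin n → ℝ) → (Fin m → ℝ)) : Prop :=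
  ∃ (A : Matrix (Fin m) (Fin n) ℝ) (b : Fin m → ℝ), ∀ x, T x = A.mulVec x + b

/-- `T` is a linear transformation. -/
def IsLinearT {n m : ℕ} (T : (Fin n → ℝ) → (Fin m → ℝ)) : Prop :=
  ∃ A : Matrix (Fin m) (Fin n) ℝ, ∀ x, T x = A.mulVec x

/-- `RepresentsWith ws f` : the function `f : ℝ^n → ℝ^m` is computed by a ReLU DNN whose
hidden layers have widths given by the list `ws` (so the DNN has `ws.length` hidden layers,
depth `ws.length + 1` and size `ws.sum`). -/
def RepresentsWithAux : List ℕ → (n m : ℕ) → ((Fin n → ℝ) → (Fin m → ℝ)) → Prop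
  | [], _, _, f => IsLinearT f
  | w :: ws, n, m, f =>
      ∃ (T : (Fin n → ℝ) → (Fin w → ℝ)) (g : (Fin w → ℝ) → (Fin m → ℝ)),
        IsAffineT T ∧ RepresentsWithAux ws w m g ∧ ∀ x, f x = g (reluVec (T x))

/-- See `RepresentsWithAux`. -/
def RepresentsWith (ws : List ℕ) {n m : ℕ} (f : (Fin n → ℝ) → (Fin m → ℝ)) : Prop :=
  RepresentsWithAux ws n m f

/-- Representability for real-valued functions on `ℝ^n`. -/
def RepresentsR (ws : List ℕ) {n : ℕ} (f : (Fin n → ℝ) → ℝ) : Prop :=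
  RepresentsWith ws (fun x => fun _ : Fin 1 => f x)

/-- Representability for `ℝ → ℝ` functions. -/
def Represents1D (ws : List ℕ) (f : ℝ → ℝ) : Prop :=
  RepresentsWith ws (fun x : Fin 1 → ℝ => fun _ : Fin 1 => f (x 0))

/-- `f` agrees with an affine function on the set `S`. -/
def AffineOnSet {n : ℕ} (f : (Fin n → ℝ) → ℝ) (S : Set (Fin n → ℝ)) : Prop :=
  ∃ (c : Fin n → ℝ) (d : ℝ), ∀ x ∈ S, f x = (∑ j, c j * x j) + d

/-- A polyhedron: the intersection of finitely many halfspaces. -/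
def IsPolyhedron {n : ℕ} (P : Set (Fin n → ℝ)) : Prop :=
  ∃ (m : ℕ) (A : Fin m → Fin n → ℝ) (b : Fin m → ℝ),
    P = {x | ∀ i, (∑ j, A i j * x j) ≤ b i}

/-- Continuous piecewise linear function on `ℝ^n`: finitely many polyhedra covering `ℝ^n`,
with `f` affine on each. -/
def IsPWL {n : ℕ} (f : (Fin n → ℝ) → ℝ) : Prop :=
  ∃ (N : ℕ) (P : Fin N → Set (Fin n → ℝ)),
    (∀ i, IsPolyhedron (P i)) ∧ (⋃ i, P i) = Set.univ ∧ ∀ i, AffineOnSet f (P i)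

/-- `f : ℝ → ℝ` is piecewise linear with breakpoints `b 0 < b 1 < ⋯ < b (q-1)`, being affine
with slope `sl i` and intercept `ic i` on the `i`-th of the `q+1` closed pieces into which the
breakpoints partition `ℝ`. -/
def RealizesPieces (q : ℕ) (b : Fin q → ℝ) (sl ic : Fin (q+1) → ℝ) (f : ℝ → ℝ) : Prop :=
  StrictMono b ∧
  ∀ (i : Fin (q+1)) (x : ℝ),
    (∀ j : Fin q, (j : ℕ) < (i : ℕ) → b j ≤ x) →
    (∀ j : Fin q, (i : ℕ) ≤ (j : ℕ) → x ≤ b j) →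
    f x = sl i * x + ic i

/-- `f : ℝ → ℝ` is continuous piecewise linear with exactly `p` pieces: `ℝ` is partitioned into
`p` intervals on each of which `f` is affine, and consecutive pieces have different slopes. -/
def PWLPiecesExact (p : ℕ) (f : ℝ → ℝ) : Prop :=
  ∃ q : ℕ, p = q + 1 ∧ ∃ (b : Fin q → ℝ) (sl ic : Fin (q+1) → ℝ),
    RealizesPieces q b sl ic f ∧ ∀ i : Fin q, sl i.castSucc ≠ sl i.succ

/-- `f : ℝ → ℝ` is continuous piecewise linear with at most `p` pieces. -/
def PWLPiecesAtMost (p : ℕ) (f : ℝ → ℝ) : Prop :=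
  ∃ q : ℕ, q + 1 ≤ p ∧ ∃ (b : Fin q → ℝ) (sl ic : Fin (q+1) → ℝ),
    RealizesPieces q b sl ic f

/-- Membership in the simplex `Δ^p_M = {x : 0 < x 0 < x 1 < ⋯ < x (p-1) < M}`. -/
def InSimplex (M : ℝ) {p : ℕ} (a : Fin p → ℝ) : Prop :=
  StrictMono a ∧ (∀ i, 0 < a i) ∧ ∀ i, a i < M

/-- The knots `0, a 0, a 1, …, a (p-1), M` of the function `h_a`. -/
def knot (M : ℝ) {p : ℕ} (a : Fin p → ℝ) (i : Fin (p+2)) : ℝ :=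
  if _h0 : (i : ℕ) = 0 then 0
  else if _h1 : (i : ℕ) = p + 1 then M
  else a ⟨(i : ℕ) - 1, by have := i.isLt; omega⟩

/-- The prescribed value of `h_a` at the `i`-th knot: it alternates `0, M, 0, M, …`. -/
def knotVal (M : ℝ) (p : ℕ) (i : Fin (p+2)) : ℝ :=
  if (i : ℕ) % 2 = 1 then M else 0

/-- `h` is the function `h_a` associated with `a ∈ Δ^p_M`: it vanishes on `(-∞,0]`, is affine on
each interval between consecutive knots with the prescribed alternating values `0,M,0,M,…` at
the knots, and for `x ≥ M` it linearly continues the piece on `[a (p-1), M]`. -/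
def IsHa (M : ℝ) {p : ℕ} (a : Fin p → ℝ) (h : ℝ → ℝ) : Prop :=
  (∀ x : ℝ, x ≤ 0 → h x = 0) ∧
  (∀ i : Fin (p+1), ∀ t ∈ Set.Icc (0:ℝ) 1,
      h ((1 - t) * knot M a i.castSucc + t * knot M a i.succ)
        = (1 - t) * knotVal M p i.castSucc + t * knotVal M p i.succ) ∧
  (∀ x : ℝ, M ≤ x →
      h x = knotVal M p (Fin.last (p+1))
        + (x - M) * ((knotVal M p (Fin.last (p+1)) - knotVal M p ⟨p, by omega⟩)
            / (M - knot M a ⟨p, by omega⟩)))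

/-- The composition `h (k-1) ∘ ⋯ ∘ h 1 ∘ h 0` of a finite family of `ℝ → ℝ` functions. -/
def compFold {k : ℕ} (h : Fin k → ℝ → ℝ) : ℝ → ℝ :=
  fun x => (List.ofFn h).foldl (fun y g => g y) x

/-- `[0,M]` is partitioned into exactly `N` subintervals, on each of which `f` is affine
with minimum value `0` and maximum value `M`. -/
def PartitionAffineMinMax (f : ℝ → ℝ) (M : ℝ) (N : ℕ) : Prop :=
  ∃ c : Fin (N+1) → ℝ, StrictMono c ∧ c 0 = 0 ∧ c (Fin.last N) = M ∧
    ∀ i : Fin N,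
      (∃ s d : ℝ, ∀ x ∈ Set.Icc (c i.castSucc) (c i.succ), f x = s * x + d) ∧
      (∀ x ∈ Set.Icc (c i.castSucc) (c i.succ), 0 ≤ f x ∧ f x ≤ M) ∧
      (∃ x ∈ Set.Icc (c i.castSucc) (c i.succ), f x = 0) ∧
      (∃ x ∈ Set.Icc (c i.castSucc) (c i.succ), f x = M)

/-- `[0,M]` is partitioned into exactly `N` maximal subintervals of affinity of `f`:
`f` is affine on each subinterval and consecutive subintervals carry different slopes. -/
def PartitionAffineExact (f : ℝ → ℝ) (M : ℝ) (N : ℕ) : Prop :=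
  ∃ (c : Fin (N+1) → ℝ) (s d : Fin N → ℝ), StrictMono c ∧ c 0 = 0 ∧ c (Fin.last N) = M ∧
    (∀ i : Fin N, ∀ x ∈ Set.Icc (c i.castSucc) (c i.succ), f x = s i * x + d i) ∧
    ∀ i j : Fin N, (j : ℕ) = (i : ℕ) + 1 → s i ≠ s j

/-- The zonotope `Z(b 0, …, b (m-1)) = {λ₀ b⁰ + ⋯ + λ_{m-1} b^{m-1} : |λᵢ| ≤ 1}`. -/
def Zono {n m : ℕ} (b : Fin m → Fin n → ℝ) : Set (Fin n → ℝ) :=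
  {x | ∃ lam : Fin m → ℝ, (∀ i, |lam i| ≤ 1) ∧ x = ∑ i, lam i • b i}

/-- The set of maximal connected subsets of `ℝ^n` on which `f` is affine (the "pieces"). -/
def MaxAffinePieces {n : ℕ} (f : (Fin n → ℝ) → ℝ) : Set (Set (Fin n → ℝ)) :=
  {S | IsConnected S ∧ AffineOnSet f S ∧
    ∀ S', IsConnected S' → AffineOnSet f S' → S ⊆ S' → S' = S}

end

/-- Every coordinate of `F` is affine on each closed interval whose interior avoids `B`. -/
def HasBreaksIn {n : ℕ} (B : Finset ℝ) (F : ℝ → Fin n → ℝ) : Prop :=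
  ∀ (i : Fin n) (a b : ℝ), a < b → (∀ x ∈ B, x ≤ a ∨ b ≤ x) →
    ∃ c d : ℝ, ∀ x ∈ Set.Icc a b, F x i = c * x + d

theorem HasBreaksIn.mulVec {n m : ℕ} {B : Finset ℝ} {F : ℝ → Fin n → ℝ}
    (hF : HasBreaksIn B F) (A : Matrix (Fin m) (Fin n) ℝ) :
    HasBreaksIn B fun x => A.mulVec (F x) := by
  intro i a b hab hB
  choose c d hcd using fun j => hF j a b hab hB
  refine ⟨∑ j, A i j * c j, ∑ j, A i j * d j, fun x hx => ?_⟩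
  simp only [Matrix.mulVec, dotProduct]
  rw [Finset.sum_mul, ← Finset.sum_add_distrib]
  refine Finset.sum_congr rfl fun j _ => ?_
  rw [hcd j x hx]
  ring

theorem HasBreaksIn.add_const {n : ℕ} {B : Finset ℝ} {F : ℝ → Fin n → ℝ}
    (hF : HasBreaksIn B F) (v : Fin n → ℝ) : HasBreaksIn B fun x => F x + v := by
  intro i a b hab hB
  obtain ⟨c, d, h⟩ := hF i a b hab hB
  refine ⟨c, d + v i, fun x hx => ?_⟩
  simp only [Pi.add_apply, h x hx, add_assoc]

/-- The zeros of `φ` that lie inside a gap of `B` to the left of which `φ` does not vanish. -/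
def crossings (B : Finset ℝ) (φ : ℝ → ℝ) : Set ℝ :=
  {x | φ x = 0 ∧ ∃ u v, u < x ∧ x < v ∧ (∀ y ∈ B, y ≤ u ∨ v ≤ y) ∧ φ u ≠ 0}

theorem HasBreaksIn.injOn_crossings {n : ℕ} {B : Finset ℝ} {F : ℝ → Fin n → ℝ}
    (hF : HasBreaksIn B F) (i : Fin n) :
    Set.InjOn (fun x => (B.filter (· < x)).card) (crossings B fun x => F x i) := by
  have key : ∀ x ∈ crossings B (fun x => F x i), ∀ y ∈ crossings B (fun x => F x i),
      (B.filter (· < x)).card = (B.filter (· < y)).card → ¬ x < y := by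
    rintro x ⟨hx, u, v, hux, hxv, huv, hu⟩ y ⟨hy, -⟩ hcard hxy
    have heq : B.filter (· < x) = B.filter (· < y) :=
      Finset.eq_of_subset_of_card_le
        (Finset.monotone_filter_right B fun z _ hz => hz.trans hxy) hcard.ge
    have hgap : ∀ z ∈ B, z ≤ u ∨ y ≤ z := by
      intro z hz
      by_contra! h
      have hzx : z ∈ B.filter (· < x) := heq ▸ Finset.mem_filter.2 ⟨hz, h.2⟩
      have := (Finset.mem_filter.1 hzx).2
      rcases huv z hz with h' | h' <;> linarith
    obtain ⟨c, d, h⟩ := hF i u y (hux.trans hxy) hgap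
    have h1 := h x ⟨hux.le, hxy.le⟩
    have h2 := h y ⟨(hux.trans hxy).le, le_rfl⟩
    have h3 := h u ⟨le_rfl, (hux.trans hxy).le⟩
    simp only at hx hy hu
    have hc : c * (y - x) = 0 := by linarith
    have hc0 : c = 0 := by
      rcases mul_eq_zero.1 hc with h' | h'
      · exact h'
      · linarith
    subst hc0
    exact hu (by linarith)
  intro x hx y hy hxy
  exact le_antisymm (not_lt.1 (key y hy x hx hxy.symm)) (not_lt.1 (key x hx y hy hxy))

theorem HasBreaksIn.exists_finset_crossings {n : ℕ} {B : Finset ℝ} {F : ℝ → Fin n → ℝ}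
    (hF : HasBreaksIn B F) (i : Fin n) :
    ∃ Z : Finset ℝ, (Z : Set ℝ) = crossings B (fun x => F x i) ∧ Z.card ≤ B.card + 1 := by
  have hmaps : Set.MapsTo (fun x => (B.filter (· < x)).card) (crossings B fun x => F x i)
      (Finset.range (B.card + 1) : Set ℕ) := fun x _ => by
    simpa [Nat.lt_succ_iff] using Finset.card_filter_le B (· < x)
  have hfin := Set.Finite.of_injOn hmaps (hF.injOn_crossings i) (Finset.finite_toSet _)
  refine ⟨hfin.toFinset, hfin.coe_toFinset, ?_⟩
  rw [← Finset.card_range (B.card + 1)]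
  exact Finset.card_le_card_of_injOn _ (by simpa using hmaps)
    (by simpa using hF.injOn_crossings i)

theorem HasBreaksIn.exists_reluVec {n : ℕ} {B : Finset ℝ} {F : ℝ → Fin n → ℝ}
    (hF : HasBreaksIn B F) :
    ∃ B' : Finset ℝ, HasBreaksIn B' (fun x => reluVec (F x)) ∧
      B'.card + 1 ≤ (B.card + 1) * (n + 1) := by
  choose Z hZ hZc using hF.exists_finset_crossings
  refine ⟨B ∪ Finset.univ.biUnion Z, ?_, ?_⟩
  · intro i a b hab hB'
    have hB : ∀ x ∈ B, x ≤ a ∨ b ≤ x := fun x hx => hB' x (Finset.mem_union_left _ hx)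
    have hZ' : ∀ x ∈ crossings B (fun x => F x i), x ≤ a ∨ b ≤ x := by
      intro x hx
      rw [← hZ i, Finset.mem_coe] at hx
      exact hB' x (Finset.mem_union_right _ (Finset.mem_biUnion.2 ⟨i, Finset.mem_univ _, hx⟩))
    obtain ⟨c, d, h⟩ := hF i a b hab hB
    have hside : ∀ x ∈ Set.Ioo a b, F x i = 0 → F a i = 0 := by
      intro x hx h0
      by_contra ha
      rcases hZ' x ⟨h0, a, b, hx.1, hx.2, hB, ha⟩ with h' | h'
      · exact absurd hx.1 (not_lt.2 h')
      · exact absurd hx.2 (not_lt.2 h')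
    have ha := h a ⟨le_rfl, hab.le⟩
    have hb := h b ⟨hab.le, le_rfl⟩
    have hnot : ¬ F a i * F b i < 0 := by
      intro hlt
      have hc : c ≠ 0 := by
        rintro rfl
        rw [ha, hb] at hlt
        nlinarith [mul_self_nonneg d]
      have hd : c * (-d / c) + d = 0 := by field_simp; ring
      have hx : -d / c ∈ Set.Ioo a b := by
        set x := -d / c
        have e1 : F a i = c * (a - x) := by rw [ha]; linarith
        have e2 : F b i = c * (b - x) := by rw [hb]; linarith
        rw [e1, e2] at hlt
        have hpos : 0 < c * c := mul_self_pos.2 hc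
        have hprod : (a - x) * (b - x) < 0 := by
          by_contra! hge
          nlinarith [mul_nonneg hpos.le hge]
        rcases mul_neg_iff.1 hprod with h' | h'
        · linarith [h'.1, h'.2]
        · exact ⟨by linarith [h'.1], by linarith [h'.2]⟩
      have h0 := hside _ hx (by rw [h _ (Set.Ioo_subset_Icc_self hx), hd])
      rw [h0, zero_mul] at hlt
      exact lt_irrefl _ hlt
    have hinterp : ∀ x ∈ Set.Icc a b,
        F x i * (b - a) = F a i * (b - x) + F b i * (x - a) := by
      intro x hx
      rw [h x hx, ha, hb]
      ring
    have hsign : (0 ≤ F a i ∧ 0 ≤ F b i) ∨ (F a i ≤ 0 ∧ F b i ≤ 0) :=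
      mul_nonneg_iff.1 (not_lt.1 hnot)
    have hba : 0 < b - a := sub_pos.2 hab
    rcases hsign with ⟨h1, h2⟩ | ⟨h1, h2⟩
    · refine ⟨c, d, fun x hx => ?_⟩
      have : 0 ≤ F x i * (b - a) := by
        rw [hinterp x hx]
        exact add_nonneg (mul_nonneg h1 (sub_nonneg.2 hx.2)) (mul_nonneg h2 (sub_nonneg.2 hx.1))
      simp only [reluVec]
      rw [max_eq_left (nonneg_of_mul_nonneg_left this hba), h x hx]
    · refine ⟨0, 0, fun x hx => ?_⟩
      have : F x i * (b - a) ≤ 0 := by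
        rw [hinterp x hx]
        exact add_nonpos (mul_nonpos_of_nonpos_of_nonneg h1 (sub_nonneg.2 hx.2))
          (mul_nonpos_of_nonpos_of_nonneg h2 (sub_nonneg.2 hx.1))
      have hx0 : F x i ≤ 0 := by
        by_contra! hpos
        exact absurd (mul_pos hpos hba) (not_lt.2 this)
      simp only [reluVec]
      rw [max_eq_right hx0]
      ring
  · have h1 : (Finset.univ.biUnion Z).card ≤ n * (B.card + 1) := by
      simpa using Finset.card_biUnion_le_card_mul Finset.univ Z (B.card + 1) fun i _ => hZc i
    calc (B ∪ Finset.univ.biUnion Z).card + 1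
        ≤ B.card + n * (B.card + 1) + 1 := by
          have := Finset.card_union_le B (Finset.univ.biUnion Z)
          omega
      _ = (B.card + 1) * (n + 1) := by ring

theorem HasBreaksIn.exists_comp_representsWithAux (ws : List ℕ) :
    ∀ {n m : ℕ} {f : (Fin n → ℝ) → Fin m → ℝ}, RepresentsWithAux ws n m f →
      ∀ {B : Finset ℝ} {F : ℝ → Fin n → ℝ}, HasBreaksIn B F →
        ∃ B' : Finset ℝ, HasBreaksIn B' (fun x => f (F x)) ∧
          B'.card + 1 ≤ (B.card + 1) * (ws.map (· + 1)).prod := by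
  induction ws with
  | nil =>
    rintro n m f ⟨A, hA⟩ B F hF
    refine ⟨B, ?_, by simp⟩
    simpa only [hA] using hF.mulVec A
  | cons w ws ih =>
    rintro n m f ⟨T, g, ⟨A, v, hT⟩, hg, hf⟩ B F hF
    obtain ⟨B₁, hB₁, hc₁⟩ := ((hF.mulVec A).add_const v).exists_reluVec
    obtain ⟨B₂, hB₂, hc₂⟩ := ih hg hB₁
    refine ⟨B₂, by simpa only [hf, hT] using hB₂, hc₂.trans ?_⟩
    rw [List.map_cons, List.prod_cons, ← mul_assoc]
    exact Nat.mul_le_mul_right _ hc₁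

theorem RealizesPieces.mem_of_slope_ne {q : ℕ} {b : Fin q → ℝ} {sl ic : Fin (q + 1) → ℝ}
    {f : ℝ → ℝ} (hf : RealizesPieces q b sl ic f) {B : Finset ℝ}
    (hB : HasBreaksIn B fun x (_ : Fin 1) => f x) (i : Fin q)
    (hi : sl i.castSucc ≠ sl i.succ) : b i ∈ B := by
  by_contra hmem
  obtain ⟨hmono, hpiece⟩ := hf
  let S : Finset ℝ := B ∪ Finset.univ.image b
  have hleft : ∀ᶠ x in nhdsWithin (b i) (Set.Iio (b i)), x < b i ∧ ∀ y ∈ S, y < b i → y < x :=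
    eventually_mem_nhdsWithin.and <| (Finset.eventually_all S).2 fun y _ => by
      by_cases hy : y < b i
      · exact ((eventually_gt_nhds hy).filter_mono nhdsWithin_le_nhds).mono fun _ h _ => h
      · exact Filter.Eventually.of_forall fun _ h => absurd h hy
  have hright : ∀ᶠ x in nhdsWithin (b i) (Set.Ioi (b i)), b i < x ∧ ∀ y ∈ S, b i < y → x < y :=
    eventually_mem_nhdsWithin.and <| (Finset.eventually_all S).2 fun y _ => by
      by_cases hy : b i < y
      · exact ((eventually_lt_nhds hy).filter_mono nhdsWithin_le_nhds).mono fun _ h _ => h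
      · exact Filter.Eventually.of_forall fun _ h => absurd h hy
  obtain ⟨u, hu, hu'⟩ := hleft.exists
  obtain ⟨v, hv, hv'⟩ := hright.exists
  have hbS : ∀ j, b j ∈ S := fun j =>
    Finset.mem_union_right _ (Finset.mem_image_of_mem b (Finset.mem_univ j))
  have hgap : ∀ x ∈ B, x ≤ u ∨ v ≤ x := by
    intro x hx
    have hxS : x ∈ S := Finset.mem_union_left _ hx
    rcases lt_trichotomy x (b i) with h | h | h
    · exact Or.inl (hu' x hxS h).le
    · exact absurd (h ▸ hx) hmem
    · exact Or.inr (hv' x hxS h).le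
  obtain ⟨c, d, hcd⟩ := hB 0 u v (hu.trans hv) hgap
  have hL : ∀ x ∈ Set.Icc u (b i), f x = sl i.castSucc * x + ic i.castSucc := by
    intro x hx
    refine hpiece _ x (fun j hj => ?_) fun j hj => ?_
    · exact (hu' _ (hbS j) (hmono (Fin.lt_def.2 hj))).le.trans hx.1
    · exact hx.2.trans (hmono.monotone (Fin.le_def.2 hj))
  have hR : ∀ x ∈ Set.Icc (b i) v, f x = sl i.succ * x + ic i.succ := by
    intro x hx
    refine hpiece _ x (fun j hj => ?_) fun j hj => ?_
    · exact (hmono.monotone (Fin.le_def.2 (Nat.lt_succ_iff.1 hj))).trans hx.1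
    · exact hx.2.trans (hv' _ (hbS j) (hmono (Fin.lt_def.2 hj))).le
  have eu := hcd u ⟨le_rfl, (hu.trans hv).le⟩
  have eb := hcd (b i) ⟨hu.le, hv.le⟩
  have ev := hcd v ⟨(hu.trans hv).le, le_rfl⟩
  have lu := hL u ⟨le_rfl, hu.le⟩
  have lb := hL (b i) ⟨hu.le, le_rfl⟩
  have rb := hR (b i) ⟨le_rfl, hv.le⟩
  have rv := hR v ⟨hv.le, le_rfl⟩
  simp only at eu eb ev
  have h1 : sl i.castSucc = c :=
    mul_right_cancel₀ (sub_pos.2 hu).ne' (by linarith)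
  have h2 : sl i.succ = c :=
    mul_right_cancel₀ (sub_pos.2 hv).ne' (by linarith)
  exact hi (h1.trans h2.symm)

theorem PWLPiecesExact.le_card_add_one {p : ℕ} {f : ℝ → ℝ} (hf : PWLPiecesExact p f)
    {B : Finset ℝ} (hB : HasBreaksIn B fun x (_ : Fin 1) => f x) : p ≤ B.card + 1 := by
  obtain ⟨q, rfl, b, sl, ic, hreal, hne⟩ := hf
  have := Finset.card_le_card_of_injOn (s := Finset.univ) (t := B) b
    (fun i _ => hreal.mem_of_slope_ne hB i (hne i)) hreal.1.injective.injOn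
  simpa using this

theorem PWLPiecesExact.le_prod_of_represents1D {p : ℕ} {f : ℝ → ℝ} {ws : List ℕ}
    (hf : PWLPiecesExact p f) (hrep : Represents1D ws f) : p ≤ (ws.map (· + 1)).prod := by
  have hid : HasBreaksIn ∅ fun x (_ : Fin 1) => x := fun _ _ _ _ _ =>
    ⟨1, 0, fun x _ => by ring⟩
  obtain ⟨B, hB, hcard⟩ := HasBreaksIn.exists_comp_representsWithAux ws hrep hid
  exact (hf.le_card_add_one hB).trans (by simpa using hcard)

theorem List.prod_map_add_one_le_two_pow_mul_prod (ws : List ℕ) (hpos : ∀ u ∈ ws, 0 < u) :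
    (ws.map (· + 1)).prod ≤ 2 ^ ws.length * ws.prod := by
  induction ws with
  | nil => simp
  | cons w ws ih =>
    simp only [List.map_cons, List.prod_cons, List.length_cons]
    have hw : 0 < w := hpos w List.mem_cons_self
    calc (w + 1) * (ws.map (· + 1)).prod
        ≤ (2 * w) * (2 ^ ws.length * ws.prod) :=
          Nat.mul_le_mul (by omega) (ih fun u hu => hpos u (List.mem_cons_of_mem _ hu))
      _ = 2 ^ (ws.length + 1) * (w * ws.prod) := by ring

theorem List.prod_le_sum_div_length_pow (ws : List ℕ) (hne : 1 ≤ ws.length) :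
    (ws.prod : ℝ) ≤ ((ws.sum : ℝ) / ws.length) ^ ws.length := by
  have hlen : (0 : ℝ) < ws.length := by exact_mod_cast hne
  have h := Real.geom_mean_le_arith_mean Finset.univ (fun _ : Fin ws.length => (1 : ℝ))
    (fun i => (ws[i.1] : ℝ)) (by simp) (by simpa using hlen) (by simp)
  have hprod : ∏ i : Fin ws.length, (ws[i.1] : ℝ) = ws.prod := by
    exact_mod_cast Fin.prod_univ_getElem ws
  have hsum : ∑ i : Fin ws.length, (ws[i.1] : ℝ) = ws.sum := by
    exact_mod_cast Fin.sum_univ_getElem ws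
  simp only [Real.rpow_one, one_mul, hprod, hsum, Finset.sum_const, Finset.card_univ,
    Fintype.card_fin, nsmul_eq_mul, mul_one] at h
  rwa [Real.rpow_inv_le_iff_of_pos (by positivity) (by positivity) hlen,
    Real.rpow_natCast] at h

theorem PWLPiecesExact.le_two_mul_sum_div_length_pow {p : ℕ} {f : ℝ → ℝ} {ws : List ℕ}
    (hf : PWLPiecesExact p f) (hrep : Represents1D ws f) (hlen : 1 ≤ ws.length)
    (hpos : ∀ u ∈ ws, 0 < u) : (p : ℝ) ≤ (2 * (ws.sum : ℝ) / ws.length) ^ ws.length := by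
  calc (p : ℝ) ≤ 2 ^ ws.length * (ws.prod : ℝ) := by
        exact_mod_cast (hf.le_prod_of_represents1D hrep).trans
          (ws.prod_map_add_one_le_two_pow_mul_prod hpos)
    _ ≤ 2 ^ ws.length * ((ws.sum : ℝ) / ws.length) ^ ws.length := by
        gcongr
        exact ws.prod_le_sum_div_length_pow hlen
    _ = (2 * (ws.sum : ℝ) / ws.length) ^ ws.length := by rw [← mul_pow, mul_div_assoc]

/-- A continuous piecewise linear `f : ℝ → ℝ` with `p` pieces represented by a
ReLU DNN of depth `k+1` (with positive widths) has size at least `(1/2)·k·p^{1/k} − 1`;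
conversely, such a function represented by a ReLU DNN of depth `k+1` and size at most `s` has
at most `(2s/k)^k` pieces. -/
theorem stmt19 :
    (∀ (p k : ℕ) (f : ℝ → ℝ) (ws : List ℕ), 1 ≤ k → ws.length = k →
        (∀ u ∈ ws, 0 < u) → PWLPiecesExact p f → Represents1D ws f →
        (1/2 : ℝ) * (k : ℝ) * (p : ℝ) ^ (1/(k : ℝ)) - 1 ≤ (ws.sum : ℝ)) ∧
    (∀ (p k s : ℕ) (f : ℝ → ℝ) (ws : List ℕ), 1 ≤ k → ws.length = k →
        (∀ u ∈ ws, 0 < u) → ws.sum ≤ s → PWLPiecesExact p f → Represents1D ws f →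
        (p : ℝ) ≤ (2 * (s : ℝ) / (k : ℝ)) ^ k) := by
  refine ⟨?_, ?_⟩
  · rintro p k f ws hk rfl hpos hf hrep
    have hlen : (0 : ℝ) < ws.length := by exact_mod_cast hk
    have h := hf.le_two_mul_sum_div_length_pow hrep hk hpos
    have hroot : (p : ℝ) ^ (1 / (ws.length : ℝ)) ≤ 2 * (ws.sum : ℝ) / ws.length := by
      rw [one_div, Real.rpow_inv_le_iff_of_pos (by positivity) (by positivity) hlen,
        Real.rpow_natCast]
      exact h
    rw [le_div_iff₀ hlen] at hroot
    linarith
  · rintro p k s f ws hk rfl hpos hs hf hrep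
    refine (hf.le_two_mul_sum_div_length_pow hrep hk hpos).trans ?_
    gcongr
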